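/- Let n ≥ 2, d = 3n+1, let Φ be a Clebsch covariant of degree d, and let g ∈ V(d). Then for every h ∈ L_S one has Φ(h+g, h+g, h+g, h+g) = 4·Φ(h,g,g,g) + Φ(g,g,g,g); in particular the map h ↦ Φ(h+g,h+g,h+g,h+g) is affine-linear on L_S (this is the linearity of the restriction of S_d to ℙ(L_S + ℂg)). -/

import Mathlib

open MvPolynomial

noncomputable section

/-- The polynomial ring ℂ[x₁,x₂,x₃]. -/
abbrev MvP : Type := MvPolynomial (Fin 3) ℂ

/-- The linear form a₁x₁+a₂x₂+a₃x₃ with coefficient vector a. -/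
def lin (a : Fin 3 → ℂ) : MvP := ∑ i, C (a i) * X i

lemma lin_hom (a : Fin 3 → ℂ) : (lin a).IsHomogeneous 1 := by
  unfold lin
  apply IsHomogeneous.sum
  intro i _
  simpa using (isHomogeneous_C (Fin 3) (a i)).mul (isHomogeneous_X ℂ i)

/-- V(k): the space of homogeneous polynomials of degree k in ℂ[x₁,x₂,x₃]. -/
def V (k : ℕ) : Submodule ℂ MvP := homogeneousSubmodule (Fin 3) ℂ k

/-- l^d as an element of V(d), where l is the linear form with coefficient vector a. -/
def powV (d : ℕ) (a : Fin 3 → ℂ) : V d :=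
  ⟨lin a ^ d, by rw [V, mem_homogeneousSubmodule]; simpa using (lin_hom a).pow d⟩

/-- The bracket (l₁l₂l₃) = det(vec l₁, vec l₂, vec l₃). -/
def br (a b c : Fin 3 → ℂ) : ℂ := Matrix.det (Matrix.of ![a, b, c])

/-- I(l₁,l₂,l₃,l₄) = (l₁l₂l₃)(l₁l₂l₄)(l₁l₃l₄)(l₂l₃l₄). -/
def Icov (a b c d : Fin 3 → ℂ) : ℂ := br a b c * br a b d * br a c d * br b c d

/-- l₁l₂l₃l₄ as an element of V(4). -/
def prod4 (a b c d : Fin 3 → ℂ) : V 4 :=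
  ⟨lin a * lin b * lin c * lin d, by
    rw [V, mem_homogeneousSubmodule]
    simpa using (((lin_hom a).mul (lin_hom b)).mul (lin_hom c)).mul (lin_hom d)⟩

/-- l₁²l₂²l₃²l₄² as an element of V(8). -/
def prod4sq (a b c d : Fin 3 → ℂ) : V 8 :=
  ⟨lin a ^ 2 * lin b ^ 2 * lin c ^ 2 * lin d ^ 2, by
    rw [V, mem_homogeneousSubmodule]
    simpa using ((((lin_hom a).pow 2).mul ((lin_hom b).pow 2)).mul ((lin_hom c).pow 2)).mul
      ((lin_hom d).pow 2)⟩

/-- Φ is a Clebsch covariant of degree d = 3n+1: a symmetric quadrilinear map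
V(d)⁴ → V(4) with Φ(l₁^d,l₂^d,l₃^d,l₄^d) = I(l₁,l₂,l₃,l₄)^n · l₁l₂l₃l₄. -/
def IsClebschS (n : ℕ) (Φ : MultilinearMap ℂ (fun _ : Fin 4 => V (3*n+1)) (V 4)) : Prop :=
  (∀ (v : Fin 4 → V (3*n+1)) (σ : Equiv.Perm (Fin 4)), Φ (v ∘ σ) = Φ v) ∧
  (∀ a b c d : Fin 3 → ℂ,
    Φ ![powV (3*n+1) a, powV (3*n+1) b, powV (3*n+1) c, powV (3*n+1) d]
      = (Icov a b c d) ^ n • prod4 a b c d)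

/-- Ψ is a Clebsch covariant of degree d = 3n+2: a symmetric quadrilinear map
V(d)⁴ → V(8) with Ψ(l₁^d,l₂^d,l₃^d,l₄^d) = I(l₁,l₂,l₃,l₄)^n · l₁²l₂²l₃²l₄². -/
def IsClebschT (n : ℕ) (Ψ : MultilinearMap ℂ (fun _ : Fin 4 => V (3*n+2)) (V 8)) : Prop :=
  (∀ (v : Fin 4 → V (3*n+2)) (σ : Equiv.Perm (Fin 4)), Ψ (v ∘ σ) = Ψ v) ∧
  (∀ a b c d : Fin 3 → ℂ,
    Ψ ![powV (3*n+2) a, powV (3*n+2) b, powV (3*n+2) c, powV (3*n+2) d]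
      = (Icov a b c d) ^ n • prod4sq a b c d)

/-- Membership in L_S = x₁^{2n+3}·V(n−2): a homogeneous form of degree 3n+1 lies in L_S
iff it is divisible by x₁^{2n+3}. -/
def memLS (n : ℕ) (h : V (3*n+1)) : Prop := (X 0 : MvP) ^ (2*n+3) ∣ (h : MvP)

/-- Membership in L_T = x₁^{2n+5}·V(n−3): a homogeneous form of degree 3n+2 lies in L_T
iff it is divisible by x₁^{2n+5}. -/
def memLT (n : ℕ) (h : V (3*n+2)) : Prop := (X 0 : MvP) ^ (2*n+5) ∣ (h : MvP)

/-- The Lagrange interpolation polynomial p_i^b of degree K−1 evaluated at c. -/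
def interp {K : ℕ} (b : Fin K → ℂ) (i : Fin K) (c : ℂ) : ℂ :=
  ∏ j ∈ Finset.univ.erase i, (c - b j) / (b i - b j)

/-- f(c) = Σᵢ p_i^b(c)·l_i^d − (cx₁+y)^d where y = λx₂+μx₃ and l_i = b_i x₁ + y. -/
def fc {K : ℕ} (d : ℕ) (b : Fin K → ℂ) (lam mu c : ℂ) : MvP :=
  ∑ i, C (interp b i c) * lin ![b i, lam, mu] ^ d - lin ![c, lam, mu] ^ d

/-- f(c) as an element of V(d). -/
def fcV {K : ℕ} (d : ℕ) (b : Fin K → ℂ) (lam mu c : ℂ) : V d :=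
  ∑ i, interp b i c • powV d ![b i, lam, mu] - powV d ![c, lam, mu]

/-- The bracket (l₁l₂l₃) over an arbitrary commutative ring. -/
def brR {R : Type*} [CommRing R] (a b c : Fin 3 → R) : R := Matrix.det (Matrix.of ![a, b, c])

/-- I(l₁,l₂,l₃,l₄) over an arbitrary commutative ring. -/
def IcovR {R : Type*} [CommRing R] (a b c d : Fin 3 → R) : R :=
  brR a b c * brR a b d * brR a c d * brR b c d

/-- The binomial coefficient polynomial X(X−1)⋯(X−m+1)/m! over ℂ. -/
def binomPoly (m : ℕ) : Polynomial ℂ :=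
  Polynomial.C ((m.factorial : ℂ))⁻¹ * ∏ i ∈ Finset.range m, (Polynomial.X - Polynomial.C (i : ℂ))

/-- The mod-p binomial coefficient polynomial X(X−1)⋯(X−m+1)/m!. -/
def binomPolyZMod (p m : ℕ) : Polynomial (ZMod p) :=
  Polynomial.C ((m.factorial : ZMod p))⁻¹ *
    ∏ i ∈ Finset.range m, (Polynomial.X - Polynomial.C (i : ZMod p))

/-- c·x₁ + λx₂ + μx₃ as an element of (ℂ[x₁,x₂,x₃])[c]. -/
def cLin (lam mu : ℂ) : Polynomial MvP :=
  Polynomial.X * Polynomial.C (X 0) + Polynomial.C (C lam * X 1 + C mu * X 2)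

/-- G_n = −24 Σ_{i<k<p} I(cx₁+y, m_i, m_k, m_p)^n·(cx₁+y)·m_i m_k m_p ∈ ℂ[c,x₁,x₂,x₃],
viewed as a polynomial in c with coefficients in ℂ[x₁,x₂,x₃]. -/
def Gpoly {N : ℕ} (m : Fin N → Fin 3 → ℂ) (lam mu : ℂ) (n : ℕ) : Polynomial MvP :=
  (-24 : Polynomial MvP) *
    ∑ i, ∑ k, ∑ p,
      if i < k ∧ k < p then
        Polynomial.map (MvPolynomial.C)
          ((IcovR ![Polynomial.X, Polynomial.C lam, Polynomial.C mu]
            (fun j => Polynomial.C (m i j)) (fun j => Polynomial.C (m k j))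
            (fun j => Polynomial.C (m p j))) ^ n)
        * cLin lam mu * Polynomial.C (lin (m i) * lin (m k) * lin (m p))
      else 0

/-- The nine linear forms m₁,…,m₉ (coefficient vectors). -/
def ms : Fin 9 → Fin 3 → ℂ :=
  ![![1, 3, 9], ![-10, 1, 4], ![8, 4, 6],
    ![1, 6, -10], ![4, -8, -10], ![-3, 7, -4],
    ![0, -3, 2], ![8, -4, -4], ![-10, 4, 6]]


lemma V_ext_functional {k : ℕ} {v : V k} (hv : ∀ m, coeff m (v : MvP) = 0) : v = 0 := by
  apply Subtype.ext
  ext m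
  simpa using hv m

def cf (k : ℕ) (m : Fin 3 →₀ ℕ) : V k →ₗ[ℂ] ℂ := (lcoeff ℂ m).comp (V k).subtype

lemma cf_apply (k : ℕ) (m : Fin 3 →₀ ℕ) (v : V k) : cf k m v = coeff m (v : MvP) := rfl

/-- monomial as element of V -/
def mon (d : ℕ) (m : Fin 3 →₀ ℕ) (hm : m.degree = d) : V d :=
  ⟨monomial m 1, by rw [V, mem_homogeneousSubmodule]; exact isHomogeneous_monomial _ hm⟩

lemma V_deg {d : ℕ} (h : V d) {m : Fin 3 →₀ ℕ} (hm : m ∈ (h : MvP).support) : m.degree = d := by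
  have h1 : (h : MvP).IsHomogeneous d := (mem_homogeneousSubmodule d (h : MvP)).1 h.2
  rw [Finsupp.degree_eq_weight_one]
  exact h1 (mem_support_iff.1 hm)

lemma V_decomp {d : ℕ} (h : V d) :
    h = ∑ m : (h : MvP).support, coeff m.1 (h : MvP) • mon d m.1 (V_deg h m.2) := by
  apply Subtype.ext
  rw [Submodule.coe_sum]
  conv_lhs => rw [as_sum (h : MvP)]
  rw [← Finset.sum_coe_sort]
  apply Finset.sum_congr rfl
  intro m _
  simp [mon, smul_monomial]

lemma span_pow (d : ℕ) : Submodule.span ℂ (Set.range (powV d)) = ⊤ := by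
  by_contra hne
  obtain ⟨L, hL0, hL⟩ := Submodule.exists_le_ker_of_lt_top _ (lt_top_iff_ne_top.2 hne)
  apply hL0
  have hpow : ∀ a, L (powV d a) = 0 := fun a => hL (Submodule.subset_span ⟨a, rfl⟩)
  classical
  let S : Finset (Fin 3 → ℕ) := Finset.univ.piAntidiag d
  have hS : ∀ k ∈ S, (Finsupp.equivFunOnFinite.symm k).degree = d := by
    intro k hk
    have := (Finset.mem_piAntidiag.1 hk).1
    rw [Finsupp.degree_eq_sum]
    simpa using this
  have hexp : ∀ a, powV d a = ∑ k : S, ((Nat.multinomial Finset.univ k.1 : ℂ) * ∏ i, a i ^ k.1 i) •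
      mon d _ (hS k.1 k.2) := by
    intro a
    apply Subtype.ext
    rw [Submodule.coe_sum]
    simp only [powV, lin]
    rw [Finset.sum_pow_eq_sum_piAntidiag, ← Finset.sum_coe_sort]
    apply Finset.sum_congr rfl
    intro k _
    simp only [mon, Submodule.coe_smul, smul_monomial, mul_pow, Finset.prod_mul_distrib]
    rw [monomial_eq, Finsupp.prod_fintype _ _ (by simp)]
    simp [smul_eq_mul, mul_assoc]
  let P : MvP := ∑ k : S, monomial (Finsupp.equivFunOnFinite.symm k.1)
    ((Nat.multinomial Finset.univ k.1 : ℂ) * L (mon d _ (hS k.1 k.2)))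
  have hP : P = 0 := by
    apply MvPolynomial.funext
    intro a
    have := hpow a
    rw [hexp, map_sum] at this
    simp only [P, map_sum, map_zero]
    rw [← this]
    apply Finset.sum_congr rfl
    intro k _
    rw [eval_monomial, Finsupp.prod_fintype _ _ (by simp)]
    simp
    ring
  have hmon : ∀ m hm, L (mon d m hm) = 0 := by
    intro m hm
    have hmS : (m : Fin 3 → ℕ) ∈ S := by
      rw [Finset.mem_piAntidiag]
      refine ⟨?_, by simp⟩
      rw [← hm, Finsupp.degree_eq_sum]
    have h1 : coeff m P = 0 := by rw [hP]; simp
    simp only [P, coeff_sum, coeff_monomial] at h1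
    rw [Finset.sum_eq_single ⟨(m : Fin 3 → ℕ), hmS⟩] at h1
    · simp only [Finsupp.equivFunOnFinite_symm_coe, if_true] at h1
      rcases mul_eq_zero.1 h1 with h2 | h2
      · exact absurd h2 (by exact_mod_cast (Nat.multinomial_pos _ _).ne')
      · exact h2
    · intro b _ hb
      rw [if_neg]
      intro hbm
      apply hb
      apply Subtype.ext
      simp [← hbm]
    · simp
  ext h
  rw [V_decomp h, map_sum]
  simp [hmon]

def sc (t : ℂ) (a : Fin 3 → ℂ) : Fin 3 → ℂ := ![t * a 0, a 1, a 2]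

def Dalg (t : ℂ) : MvP →ₐ[ℂ] MvP := aeval ![C t * X 0, X 1, X 2]

def D (d : ℕ) (t : ℂ) : V d →ₗ[ℂ] V d :=
  (Dalg t).toLinearMap.restrict (by
    intro p hp
    rw [V, mem_homogeneousSubmodule] at hp ⊢
    have := hp.aeval (![C t * X 0, X 1, X 2] : Fin 3 → MvP) (n := 1) (by
      intro i
      fin_cases i
      · simpa using (isHomogeneous_C (Fin 3) t).mul (isHomogeneous_X ℂ 0)
      · exact isHomogeneous_X ℂ 1
      · exact isHomogeneous_X ℂ 2)
    simpa [Dalg] using this)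

lemma D_coe (d : ℕ) (t : ℂ) (v : V d) : ((D d t v : V d) : MvP) = Dalg t v := rfl

lemma D_pow (d : ℕ) (t : ℂ) (a : Fin 3 → ℂ) : D d t (powV d a) = powV d (sc t a) := by
  apply Subtype.ext
  rw [D_coe]
  simp only [powV, map_pow]
  congr 1
  simp [lin, Dalg, sc, Fin.sum_univ_three, algebraMap_eq]
  ring

lemma D_mon (d : ℕ) (t : ℂ) (m hm) : D d t (mon d m hm) = t ^ (m 0) • mon d m hm := by
  apply Subtype.ext
  rw [D_coe]
  simp only [mon, Submodule.coe_smul]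
  rw [Dalg, aeval_monomial, monomial_eq, Finsupp.prod_fintype _ _ (by simp),
    Finsupp.prod_fintype _ _ (by simp)]
  simp [Fin.prod_univ_three, smul_eq_C_mul]
  ring

def PD (k : ℕ) (F : ℂ → ℂ) : Prop := ∃ p : Polynomial ℂ, p.natDegree ≤ k ∧ ∀ t, F t = p.eval t

lemma PD.add {k F G} (hF : PD k F) (hG : PD k G) : PD k (fun t => F t + G t) := by
  obtain ⟨p, hp, hp'⟩ := hF
  obtain ⟨q, hq, hq'⟩ := hG
  exact ⟨p + q, (Polynomial.natDegree_add_le_of_degree_le hp hq), fun t => by simp [hp', hq']⟩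

lemma PD.mul {k l F G} (hF : PD k F) (hG : PD l G) : PD (k + l) (fun t => F t * G t) := by
  obtain ⟨p, hp, hp'⟩ := hF
  obtain ⟨q, hq, hq'⟩ := hG
  exact ⟨p * q, (Polynomial.natDegree_mul_le_of_le hp hq), fun t => by simp [hp', hq']⟩

lemma PD.const (k) (c : ℂ) : PD k (fun _ => c) := ⟨Polynomial.C c, by simp, by simp⟩

lemma PD.smul {k F} (c : ℂ) (hF : PD k F) : PD k (fun t => c * F t) := by
  simpa using (PD.const 0 c).mul hF

lemma PD.pow {k F} (hF : PD k F) (n : ℕ) : PD (n * k) (fun t => F t ^ n) := by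
  obtain ⟨p, hp, hp'⟩ := hF
  exact ⟨p ^ n, Polynomial.natDegree_pow_le_of_le n hp, fun t => by simp [hp']⟩

lemma PD.congr {k F G} (hF : PD k F) (h : ∀ t, G t = F t) : PD k G := by
  rwa [_root_.funext h]

lemma PD.lin (A B : ℂ) : PD 1 (fun t => A * t + B) :=
  ⟨Polynomial.C A * Polynomial.X + Polynomial.C B, Polynomial.natDegree_linear_le, by simp⟩

lemma PD.quad (A B E : ℂ) : PD 2 (fun t => A * t ^ 2 + B * t + E) :=
  ⟨Polynomial.C A * Polynomial.X ^ 2 + Polynomial.C B * Polynomial.X + Polynomial.C E,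
    Polynomial.natDegree_quadratic_le, by simp⟩

lemma PD.zero_of_pow {k r : ℕ} {c : ℂ} (h : PD k (fun t => t ^ r * c)) (hr : k < r) : c = 0 := by
  obtain ⟨p, hp, hp'⟩ := h
  have : Polynomial.C c * Polynomial.X ^ r = p := by
    apply Polynomial.funext
    intro t
    rw [← hp' t, Polynomial.eval_mul, Polynomial.eval_C, Polynomial.eval_pow, Polynomial.eval_X,
      mul_comm]
  have h2 := Polynomial.coeff_eq_zero_of_natDegree_lt (lt_of_le_of_lt hp hr)
  rw [← this] at h2
  simpa using h2

lemma PD_Icov (a b c e : Fin 3 → ℂ) : PD 4 (fun t => Icov (sc t a) (sc t b) c e) := by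
  have h1 : ∀ c, PD 1 (fun t => br (sc t a) (sc t b) c) := fun c =>
    (PD.lin (a 0 * b 1 * c 2 - a 0 * b 2 * c 1 - a 1 * b 0 * c 2 + a 2 * b 0 * c 1)
      (a 1 * b 2 * c 0 - a 2 * b 1 * c 0)).congr (by
      intro t; simp [br, sc, Matrix.det_fin_three]; ring)
  have h2 : ∀ a, PD 1 (fun t => br (sc t a) c e) := fun a =>
    (PD.lin (a 0 * c 1 * e 2 - a 0 * c 2 * e 1)
      (- a 1 * c 0 * e 2 + a 1 * c 2 * e 0 + a 2 * c 0 * e 1 - a 2 * c 1 * e 0)).congr (by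
      intro t; simp [br, sc, Matrix.det_fin_three]; ring)
  exact (((h1 c).mul (h1 e)).mul (h2 a)).mul (h2 b)

lemma PD_prod (m) (a b c e : Fin 3 → ℂ) :
    PD 2 (fun t => cf 4 m (prod4 (sc t a) (sc t b) c e)) := by
  let A : MvP := C (a 0) * X 0
  let A' : MvP := C (a 1) * X 1 + C (a 2) * X 2
  let B : MvP := C (b 0) * X 0
  let B' : MvP := C (b 1) * X 1 + C (b 2) * X 2
  let R : MvP := lin c * lin e
  refine (PD.quad (coeff m (A * B * R)) (coeff m ((A * B' + A' * B) * R))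
    (coeff m (A' * B' * R))).congr ?_
  intro t
  have : ((prod4 (sc t a) (sc t b) c e : V 4) : MvP) =
      C (t ^ 2) * (A * B * R) + C t * ((A * B' + A' * B) * R) + A' * B' * R := by
    simp only [prod4, R]
    have : ∀ a, lin (sc t a) = C t * (C (a 0) * X 0) + (C (a 1) * X 1 + C (a 2) * X 2) := by
      intro a
      simp [lin, sc, Fin.sum_univ_three]
      ring
    rw [this, this, C_pow]
    simp only [A, A', B, B']
    ring
  rw [cf_apply, this]
  simp only [coeff_add, coeff_C_mul]
  ring

lemma up0 {M : Type*} (a b c d y : M) :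
    Function.update ![a, b, c, d] 0 y = ![y, b, c, d] := by
  funext j; fin_cases j <;> rfl

lemma up1 {M : Type*} (a b c d y : M) :
    Function.update ![a, b, c, d] 1 y = ![a, y, c, d] := by
  funext j; fin_cases j <;> rfl

lemma up2 {M : Type*} (a b c d y : M) :
    Function.update ![a, b, c, d] 2 y = ![a, b, y, d] := by
  funext j; fin_cases j <;> rfl

lemma up3 {M : Type*} (a b c d y : M) :
    Function.update ![a, b, c, d] 3 y = ![a, b, c, y] := by
  funext j; fin_cases j <;> rfl

section
variable {M N : Type*} [AddCommGroup M] [Module ℂ M] [AddCommGroup N] [Module ℂ N]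
  (Φ : MultilinearMap ℂ (fun _ : Fin 4 => M) N)

lemma ma0 (x y b c d : M) : Φ ![x + y, b, c, d] = Φ ![x, b, c, d] + Φ ![y, b, c, d] := by
  have := Φ.map_update_add ![x, b, c, d] 0 x y
  simp only [up0] at this
  exact this

lemma ma1 (x y b c d : M) : Φ ![b, x + y, c, d] = Φ ![b, x, c, d] + Φ ![b, y, c, d] := by
  have := Φ.map_update_add ![b, x, c, d] 1 x y
  simp only [up1] at this
  exact this

lemma ma2 (x y b c d : M) : Φ ![b, c, x + y, d] = Φ ![b, c, x, d] + Φ ![b, c, y, d] := by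
  have := Φ.map_update_add ![b, c, x, d] 2 x y
  simp only [up2] at this
  exact this

lemma ma3 (x y b c d : M) : Φ ![b, c, d, x + y] = Φ ![b, c, d, x] + Φ ![b, c, d, y] := by
  have := Φ.map_update_add ![b, c, d, x] 3 x y
  simp only [up3] at this
  exact this

lemma ms0 (k : ℂ) (x b c d : M) : Φ ![k • x, b, c, d] = k • Φ ![x, b, c, d] := by
  have := Φ.map_update_smul ![x, b, c, d] 0 k x
  simp only [up0] at this
  exact this

lemma ms1 (k : ℂ) (x b c d : M) : Φ ![b, k • x, c, d] = k • Φ ![b, x, c, d] := by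
  have := Φ.map_update_smul ![b, x, c, d] 1 k x
  simp only [up1] at this
  exact this

lemma ms2 (k : ℂ) (x b c d : M) : Φ ![b, c, k • x, d] = k • Φ ![b, c, x, d] := by
  have := Φ.map_update_smul ![b, c, x, d] 2 k x
  simp only [up2] at this
  exact this

lemma ms3 (k : ℂ) (x b c d : M) : Φ ![b, c, d, k • x] = k • Φ ![b, c, d, x] := by
  have := Φ.map_update_smul ![b, c, d, x] 3 k x
  simp only [up3] at this
  exact this
end

lemma pow_ind {d : ℕ} {Q : V d → Prop} (hp : ∀ a, Q (powV d a))
    (ha : ∀ x y, Q x → Q y → Q (x + y)) (hs : ∀ (k : ℂ) x, Q x → Q (k • x)) (x : V d) : Q x := by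
  have hx : x ∈ Submodule.span ℂ (Set.range (powV d)) := by rw [span_pow]; trivial
  induction hx using Submodule.span_induction with
  | mem x h => obtain ⟨a, rfl⟩ := h; exact hp a
  | zero => simpa using hs 0 _ (hp 0)
  | add x y _ _ h1 h2 => exact ha x y h1 h2
  | smul k x _ h => exact hs k x h

lemma PD_Phi (n : ℕ) (Φ : MultilinearMap ℂ (fun _ : Fin 4 => V (3*n+1)) (V 4))
    (hΦ : IsClebschS n Φ) (m) (x y z w : V (3*n+1)) :
    PD (n * 4 + 2) (fun t => cf 4 m (Φ ![D _ t x, D _ t y, z, w])) := by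
  induction x using pow_ind with
  | ha x x' h1 h2 => exact (h1.add h2).congr (by intro t; rw [map_add, ma0, map_add])
  | hs k x h => exact (h.smul k).congr (by intro t; rw [map_smul, ms0, map_smul, smul_eq_mul])
  | hp a =>
  induction y using pow_ind with
  | ha x x' h1 h2 => exact (h1.add h2).congr (by intro t; rw [map_add, ma1, map_add])
  | hs k x h => exact (h.smul k).congr (by intro t; rw [map_smul, ms1, map_smul, smul_eq_mul])
  | hp b =>
  induction z using pow_ind with
  | ha x x' h1 h2 => exact (h1.add h2).congr (by intro t; rw [ma2, map_add])
  | hs k x h => exact (h.smul k).congr (by intro t; rw [ms2, map_smul, smul_eq_mul])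
  | hp c =>
  induction w using pow_ind with
  | ha x x' h1 h2 => exact (h1.add h2).congr (by intro t; rw [ma3, map_add])
  | hs k x h => exact (h.smul k).congr (by intro t; rw [ms3, map_smul, smul_eq_mul])
  | hp e =>
  refine (((PD_Icov a b c e).pow n).mul (PD_prod m a b c e)).congr ?_
  intro t
  rw [D_pow, D_pow, hΦ.2, map_smul, smul_eq_mul]

lemma Phi_zero (n : ℕ) (Φ : MultilinearMap ℂ (fun _ : Fin 4 => V (3*n+1)) (V 4))
    (hΦ : IsClebschS n Φ) (h h' z w : V (3*n+1)) (hh : memLS n h) (hh' : memLS n h') :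
    Φ ![h, h', z, w] = 0 := by
  have key : ∀ m hm m' hm', 2 * n + 3 ≤ m 0 → 2 * n + 3 ≤ m' 0 →
      Φ ![mon _ m hm, mon _ m' hm', z, w] = 0 := by
    intro m hm m' hm' h1 h2
    apply V_ext_functional
    intro q
    rw [← cf_apply]
    have := PD_Phi n Φ hΦ q (mon _ m hm) (mon _ m' hm') z w
    refine PD.zero_of_pow (k := n * 4 + 2) (r := m 0 + m' 0) (this.congr ?_) (by omega)
    intro t
    rw [D_mon, D_mon, ms0, ms1, map_smul, map_smul, smul_eq_mul, smul_eq_mul, pow_add, mul_assoc]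
  have hsupp : ∀ f : V (3*n+1), memLS n f → ∀ m ∈ (f : MvP).support, 2 * n + 3 ≤ m 0 := by
    intro f hf m hm
    obtain ⟨q, hq⟩ := hf
    rw [hq, mem_support_iff, X_pow_eq_monomial, coeff_monomial_mul'] at hm
    by_contra hlt
    apply hm
    rw [if_neg]
    intro hle
    have := hle 0
    simp at this
    omega
  have step1 : ∀ m hm, 2 * n + 3 ≤ m 0 → Φ ![mon _ m hm, h', z, w] = 0 := by
    intro m hm h1
    have := congrArg (Φ.toLinearMap ![mon _ m hm, h', z, w] 1) (V_decomp h')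
    rw [map_sum, Finset.sum_eq_zero] at this
    · simpa only [MultilinearMap.toLinearMap_apply, up1] using this
    · intro i _
      rw [map_smul]
      have := key m hm i.1 (V_deg h' i.2) h1 (hsupp h' hh' _ i.2)
      simp only [MultilinearMap.toLinearMap_apply, up1, this, smul_zero]
  have := congrArg (Φ.toLinearMap ![h, h', z, w] 0) (V_decomp h)
  rw [map_sum, Finset.sum_eq_zero] at this
  · simpa only [MultilinearMap.toLinearMap_apply, up0] using this
  · intro i _
    rw [map_smul]
    have := step1 i.1 (V_deg h i.2) (hsupp h hh _ i.2)
    simp only [MultilinearMap.toLinearMap_apply, up0, this, smul_zero]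

theorem stmt8 (n : ℕ) (hn : 2 ≤ n)
    (Φ : MultilinearMap ℂ (fun _ : Fin 4 => V (3*n+1)) (V 4)) (hΦ : IsClebschS n Φ)
    (g : V (3*n+1)) :
    ∀ h : V (3*n+1), memLS n h →
      Φ ![h + g, h + g, h + g, h + g]
        = (4 : ℂ) • Φ ![h, g, g, g] + Φ ![g, g, g, g] := by
  intro h hh
  have sw : ∀ (x y z w : V (3*n+1)) (i j : Fin 4),
      Φ (![x, y, z, w] ∘ Equiv.swap i j) = Φ ![x, y, z, w] := fun x y z w i j => hΦ.1 _ _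
  have s01 : ∀ x y z w : V (3*n+1), Φ ![y, x, z, w] = Φ ![x, y, z, w] := by
    intro x y z w
    rw [← sw x y z w 0 1]
    congr 1; funext i; fin_cases i <;> rfl
  have s12 : ∀ x y z w : V (3*n+1), Φ ![x, z, y, w] = Φ ![x, y, z, w] := by
    intro x y z w
    rw [← sw x y z w 1 2]
    congr 1; funext i; fin_cases i <;> rfl
  have s23 : ∀ x y z w : V (3*n+1), Φ ![x, y, w, z] = Φ ![x, y, z, w] := by
    intro x y z w
    rw [← sw x y z w 2 3]
    congr 1; funext i; fin_cases i <;> rfl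
  have z0 : ∀ z w, Φ ![h, h, z, w] = 0 := fun z w => Phi_zero n Φ hΦ h h z w hh hh
  have z1 : ∀ z w, Φ ![h, z, h, w] = 0 := fun z w => by rw [s12, z0]
  have z2 : ∀ z w, Φ ![h, z, w, h] = 0 := fun z w => by rw [s23, z1]
  have z3 : ∀ z w, Φ ![z, h, h, w] = 0 := fun z w => by rw [s01, z1]
  have z4 : ∀ z w, Φ ![z, h, w, h] = 0 := fun z w => by rw [s01, z2]
  have z5 : ∀ z w, Φ ![z, w, h, h] = 0 := fun z w => by rw [s12, z4]
  have e1 : Φ ![g, h, g, g] = Φ ![h, g, g, g] := s01 _ _ _ _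
  have e2 : Φ ![g, g, h, g] = Φ ![h, g, g, g] := by rw [s12, e1]
  have e3 : Φ ![g, g, g, h] = Φ ![h, g, g, g] := by rw [s23, e2]
  simp only [ma0, ma1, ma2, ma3, z0, z1, z2, z3, z4, z5, e1, e2, e3]
  module
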